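/- arXiv:math/0507371 — 2 statements merged into one kernel-verified Lean document; each statement's English description precedes it below -/
import Mathlib

section
/- In the quotient group E8/2E8 (which has order 256), there is exactly 1 class represented by 0, exactly 120 classes each represented by exactly one pair {alpha, -alpha} of roots (vectors of norm 2), and exactly 135 classes represented by vectors of norm 4; each class represented by norm-4 vectors contains exactly 16 vectors of norm 4. -/
noncomputable section

/-- The E8 root lattice, realized in `ℚ⁸`. -/
def E8Set : Set (Fin 8 → ℚ) :=
  {x | ((∀ i, ∃ n : ℤ, x i = n) ∨ (∀ i, ∃ n : ℤ, x i = n + 1/2)) ∧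
    ∃ m : ℤ, ∑ i, x i = 2 * m}

/-- The standard bilinear form on `ℚ⁸`. -/
def ip (x y : Fin 8 → ℚ) : ℚ := ∑ i, x i * y i

/-- The coset `x + 2·E8` of a vector `x`, inside E8. -/
def cosetOf (x : Fin 8 → ℚ) : Set (Fin 8 → ℚ) :=
  {y | y ∈ E8Set ∧ ∃ z ∈ E8Set, y - x = (2 : ℚ) • z}

def e8E (c : Fin 8 → ℤ) : Fin 8 → ℚ :=
  ![2 * c 0 - c 1 + c 7 / 2, c 1 - c 2 + c 7 / 2, c 2 - c 3 + c 7 / 2, c 3 - c 4 + c 7 / 2,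
    c 4 - c 5 + c 7 / 2, c 5 - c 6 + c 7 / 2, c 6 + c 7 / 2, c 7 / 2]

theorem e8E_sub (c d : Fin 8 → ℤ) : e8E c - e8E d = e8E (c - d) := by
  funext i
  fin_cases i <;> simp [e8E] <;> ring

theorem e8E_smul (c : Fin 8 → ℤ) : (2 : ℚ) • e8E c = e8E (fun i => 2 * c i) := by
  funext i
  fin_cases i <;> simp [e8E] <;> ring

theorem e8E_inj {c d : Fin 8 → ℤ} (h : e8E c = e8E d) : c = d := by
  have h0 := congrFun h 0
  have h1 := congrFun h 1
  have h2 := congrFun h 2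
  have h3 := congrFun h 3
  have h4 := congrFun h 4
  have h5 := congrFun h 5
  have h6 := congrFun h 6
  have h7 := congrFun h 7
  simp [e8E] at h0 h1 h2 h3 h4 h5 h6 h7
  have h7' : (c 7 : ℚ) = d 7 := by exact_mod_cast h7
  funext i
  have : (c i : ℚ) = d i := by
    fin_cases i <;> simp only [Fin.reduceFinMk, Fin.mk_one, Fin.zero_eta] <;> linarith
  exact_mod_cast this

theorem e8E_mem (c : Fin 8 → ℤ) : e8E c ∈ E8Set := by
  refine ⟨?_, c 0 + 2 * c 7, ?_⟩
  · rcases Int.even_or_odd' (c 7) with ⟨k, hk | hk⟩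
    · left
      intro i
      refine ⟨![2 * c 0 - c 1 + k, c 1 - c 2 + k, c 2 - c 3 + k, c 3 - c 4 + k,
        c 4 - c 5 + k, c 5 - c 6 + k, c 6 + k, k] i, ?_⟩
      fin_cases i <;> simp [e8E, hk]
    · right
      intro i
      refine ⟨![2 * c 0 - c 1 + k, c 1 - c 2 + k, c 2 - c 3 + k, c 3 - c 4 + k,
        c 4 - c 5 + k, c 5 - c 6 + k, c 6 + k, k] i, ?_⟩
      fin_cases i <;> simp [e8E, hk] <;> ring
  · simp [e8E, Fin.sum_univ_eight]
    ring

theorem e8E_surj {x : Fin 8 → ℚ} (hx : x ∈ E8Set) : ∃ c, x = e8E c := by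
  obtain ⟨h, m, hm⟩ := hx
  rw [Fin.sum_univ_eight] at hm
  rcases h with h | h
  · choose n hn using h
    simp only [hn] at hm
    have hm' : n 0 + n 1 + n 2 + n 3 + n 4 + n 5 + n 6 + n 7 = 2 * m := by exact_mod_cast hm
    refine ⟨![m - 4 * n 7, n 1 + n 2 + n 3 + n 4 + n 5 + n 6 - 6 * n 7,
      n 2 + n 3 + n 4 + n 5 + n 6 - 5 * n 7, n 3 + n 4 + n 5 + n 6 - 4 * n 7,
      n 4 + n 5 + n 6 - 3 * n 7, n 5 + n 6 - 2 * n 7, n 6 - n 7, 2 * n 7], ?_⟩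
    funext i
    fin_cases i <;> simp [e8E, hn] <;> linarith
  · choose n hn using h
    simp only [hn] at hm
    have hm' : n 0 + n 1 + n 2 + n 3 + n 4 + n 5 + n 6 + n 7 + 4 = 2 * m := by
      have : ((n 0 + n 1 + n 2 + n 3 + n 4 + n 5 + n 6 + n 7 + 4 : ℤ) : ℚ) = (2 * m : ℤ) := by
        push_cast
        linarith
      exact_mod_cast this
    refine ⟨![m - 4 * n 7 - 2, n 1 + n 2 + n 3 + n 4 + n 5 + n 6 - 6 * n 7,
      n 2 + n 3 + n 4 + n 5 + n 6 - 5 * n 7, n 3 + n 4 + n 5 + n 6 - 4 * n 7,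
      n 4 + n 5 + n 6 - 3 * n 7, n 5 + n 6 - 2 * n 7, n 6 - n 7, 2 * n 7 + 1], ?_⟩
    funext i
    fin_cases i <;> simp [e8E, hn] <;> linarith

def e8par (c : Fin 8 → ℤ) : Fin 8 → Bool := fun i => c i % 2 == 1

theorem e8par_eq (c d : Fin 8 → ℤ) : e8par c = e8par d ↔ ∀ i, c i % 2 = d i % 2 := by
  rw [funext_iff]
  refine forall_congr' fun i => ?_
  unfold e8par
  rw [Bool.eq_iff_iff, beq_iff_eq, beq_iff_eq]
  omega

theorem e8_mem_coset (c d : Fin 8 → ℤ) : e8E d ∈ cosetOf (e8E c) ↔ e8par c = e8par d := by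
  rw [e8par_eq]
  constructor
  · rintro ⟨-, z, hz, h⟩ i
    obtain ⟨e, rfl⟩ := e8E_surj hz
    rw [e8E_sub, e8E_smul] at h
    have := congrFun (e8E_inj h) i
    simp at this
    omega
  · intro h
    refine ⟨e8E_mem d, e8E (fun i => (d i - c i) / 2), e8E_mem _, ?_⟩
    rw [e8E_sub, e8E_smul]
    congr 1
    funext i
    have := h i
    simp
    omega

theorem e8_coset_eq (c d : Fin 8 → ℤ) : cosetOf (e8E c) = cosetOf (e8E d) ↔ e8par c = e8par d := by
  constructor
  · intro h
    have : e8E d ∈ cosetOf (e8E d) := (e8_mem_coset d d).2 rfl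
    rw [← h] at this
    exact (e8_mem_coset c d).1 this
  · intro h
    ext y
    constructor
    · intro hy
      obtain ⟨e, rfl⟩ := e8E_surj hy.1
      rw [e8_mem_coset] at hy ⊢
      rw [← h, hy]
    · intro hy
      obtain ⟨e, rfl⟩ := e8E_surj hy.1
      rw [e8_mem_coset] at hy ⊢
      rw [h, hy]

def e8enum (cand : List ℤ) : ℕ → ℕ → List (List ℤ)
  | 0, s => if s = 0 then [[]] else []
  | n + 1, s => cand.flatMap fun a =>
      if a.natAbs * a.natAbs ≤ s then
        (e8enum cand n (s - a.natAbs * a.natAbs)).map (fun l => a :: l) else []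

theorem e8enum_mem (cand : List ℤ) (n s : ℕ) (l : List ℤ) :
    l ∈ e8enum cand n s ↔ l.length = n ∧ (∀ a ∈ l, a ∈ cand) ∧
      (l.map fun a => a.natAbs * a.natAbs).sum = s := by
  induction n generalizing s l with
  | zero =>
    unfold e8enum
    rcases l with _ | ⟨a, l⟩
    · by_cases h : s = 0 <;> simp [h, eq_comm]
    · by_cases h : s = 0 <;> simp [h]
  | succ n ih =>
    unfold e8enum
    rw [List.mem_flatMap]
    constructor
    · rintro ⟨a, ha, h⟩
      split_ifs at h with hs
      · rw [List.mem_map] at h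
        obtain ⟨l', h', rfl⟩ := h
        obtain ⟨h1, h2, h3⟩ := (ih _ _).1 h'
        refine ⟨by simp [h1], by simpa [ha] using h2, ?_⟩
        simp only [List.map_cons, List.sum_cons, h3]
        omega
      · simp at h
    · rintro ⟨h1, h2, h3⟩
      rcases l with _ | ⟨a, l⟩
      · simp at h1
      · simp only [List.map_cons, List.sum_cons] at h3
        refine ⟨a, h2 a (by simp), ?_⟩
        rw [if_pos (by omega), List.mem_map]
        refine ⟨l, (ih _ _).2 ⟨by simpa using h1, fun b hb => h2 b (by simp [hb]), by omega⟩, rfl⟩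

theorem e8enum_nodup (cand : List ℤ) (hc : cand.Nodup) (n s : ℕ) : (e8enum cand n s).Nodup := by
  induction n generalizing s with
  | zero => unfold e8enum; split_ifs <;> simp
  | succ n ih =>
    unfold e8enum
    rw [List.nodup_flatMap]
    constructor
    · intro a _
      split_ifs
      · exact (ih _).map (fun x y h => by simpa using h)
      · simp
    · refine hc.imp ?_
      intro a b hab l h1 h2
      dsimp only at h1 h2
      split_ifs at h1 h2 <;> simp at h1 h2
      obtain ⟨x, -, rfl⟩ := h1
      obtain ⟨y, -, h⟩ := h2
      simp at h
      exact hab h.1.symm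

def e8L (m : ℕ) : List (List ℤ) :=
  (e8enum [0, 2, -2, 4, -4] 8 (4 * m) ++ e8enum [1, -1, 3, -3] 8 (4 * m)).filter
    fun l => l.sum % 4 == 0

theorem e8L_nodup (m : ℕ) : (e8L m).Nodup := by
  unfold e8L
  refine List.Nodup.filter _ (List.Nodup.append (e8enum_nodup _ (by decide) _ _)
    (e8enum_nodup _ (by decide) _ _) ?_)
  intro l h1 h2
  rw [e8enum_mem] at h1 h2
  rcases l with _ | ⟨a, l⟩
  · simp at h1
  · have h1 := h1.2.1 a (by simp)
    have h2 := h2.2.1 a (by simp)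
    simp at h1 h2
    omega

def e8toC : List ℤ → Fin 8 → ℤ
  | [a0, a1, a2, a3, a4, a5, a6, a7] =>
    ![(a0 + a1 + a2 + a3 + a4 + a5 + a6 - 7 * a7) / 4,
      (a1 + a2 + a3 + a4 + a5 + a6 - 6 * a7) / 2, (a2 + a3 + a4 + a5 + a6 - 5 * a7) / 2,
      (a3 + a4 + a5 + a6 - 4 * a7) / 2, (a4 + a5 + a6 - 3 * a7) / 2,
      (a5 + a6 - 2 * a7) / 2, (a6 - a7) / 2, a7]
  | _ => 0

def e8toL (c : Fin 8 → ℤ) : List ℤ :=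
  [4 * c 0 - 2 * c 1 + c 7, 2 * c 1 - 2 * c 2 + c 7, 2 * c 2 - 2 * c 3 + c 7,
   2 * c 3 - 2 * c 4 + c 7, 2 * c 4 - 2 * c 5 + c 7, 2 * c 5 - 2 * c 6 + c 7,
   2 * c 6 + c 7, c 7]

theorem e8toC_toL (c : Fin 8 → ℤ) : e8toC (e8toL c) = c := by
  funext i
  fin_cases i <;> simp [e8toC, e8toL] <;> omega

theorem e8toL_toC {m : ℕ} {l : List ℤ} (h : l ∈ e8L m) : e8toL (e8toC l) = l := by
  unfold e8L at h
  rw [List.mem_filter, List.mem_append, e8enum_mem, e8enum_mem] at h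
  obtain ⟨h, hs⟩ := h
  have hl : l.length = 8 := by rcases h with h | h <;> exact h.1
  have hp : (∀ a ∈ l, a % 2 = 0) ∨ (∀ a ∈ l, a % 2 = 1) := by
    rcases h with h | h
    · left
      intro a ha
      have := h.2.1 a ha
      simp at this
      omega
    · right
      intro a ha
      have := h.2.1 a ha
      simp at this
      omega
  clear h
  match l, hl with
  | [a0, a1, a2, a3, a4, a5, a6, a7], _ =>
    simp at hs hp
    simp [e8toC, e8toL]
    omega

theorem e8_ip (c : Fin 8 → ℤ) :
    ip (e8E c) (e8E c) = (((e8toL c).map fun a => a.natAbs * a.natAbs).sum : ℕ) / 4 := by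
  have h : ∀ a : ℤ, ((a.natAbs : ℕ) : ℚ) * (a.natAbs : ℕ) = a * a := by
    intro a
    have : ((a.natAbs : ℕ) : ℤ) * (a.natAbs : ℕ) = a * a := by
      simp
    have h' := congrArg (fun z : ℤ => (z : ℚ)) this
    push_cast at h'
    simp
  simp only [e8toL, List.map_cons, List.map_nil, List.sum_cons, List.sum_nil, Nat.cast_add,
    Nat.cast_mul, h]
  simp [ip, e8E, Fin.sum_univ_eight]
  ring

theorem e8_ip_iff (m : ℕ) (hm : m ≤ 4) (c : Fin 8 → ℤ) :
    ip (e8E c) (e8E c) = m ↔ e8toL c ∈ e8L m := by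
  have h4 : ip (e8E c) (e8E c) = m ↔
      ((e8toL c).map fun a => a.natAbs * a.natAbs).sum = 4 * m := by
    rw [e8_ip, div_eq_iff (by norm_num)]
    constructor
    · intro h
      have : ((((e8toL c).map fun a => a.natAbs * a.natAbs).sum : ℕ) : ℚ) = ((4 * m : ℕ) : ℚ) := by
        rw [h]; push_cast; ring
      exact_mod_cast this
    · intro h
      rw [h]; push_cast; ring
  rw [h4]
  unfold e8L
  rw [List.mem_filter, List.mem_append, e8enum_mem, e8enum_mem]
  constructor
  · intro h
    have hb : ∀ a ∈ e8toL c, a.natAbs ≤ 4 := by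
      intro a ha
      have h1 : a.natAbs * a.natAbs ≤ ((e8toL c).map fun a => a.natAbs * a.natAbs).sum :=
        List.single_le_sum (by simp) _ (List.mem_map_of_mem ha)
      nlinarith
    have hpar : ∀ a ∈ e8toL c, a % 2 = c 7 % 2 := by
      intro a ha
      simp [e8toL] at ha
      omega
    refine ⟨?_, ?_⟩
    · rcases Int.emod_two_eq_zero_or_one (c 7) with h7 | h7
      · left
        refine ⟨rfl, ?_, h⟩
        intro a ha
        have := hb a ha
        have := hpar a ha
        simp
        omega
      · right
        refine ⟨rfl, ?_, h⟩
        intro a ha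
        have := hb a ha
        have := hpar a ha
        simp
        omega
    · simp [e8toL]
      omega
  · rintro ⟨h | h, -⟩ <;> exact h.2.2

def e8split {α : Type} (k : ℕ) : List (α → Bool) → List α → Bool
  | [], L => L.length == k || L.length == 0
  | p :: ps, L => e8split k ps (L.filter p) && e8split k ps (L.filter fun x => !p x)

theorem e8split_spec {α : Type} (k : ℕ) (ps : List (α → Bool)) (L : List α)
    (h : e8split k ps L = true) (x : α) (hx : x ∈ L) :
    (L.filter fun y => ps.all fun p => p x == p y).length = k := by
  induction ps generalizing L with
  | nil =>
    simp [e8split] at h ⊢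
    rcases h with h | h
    · exact h
    · simp [h] at hx
  | cons p ps ih =>
    simp only [e8split, Bool.and_eq_true] at h
    cases hp : p x
    · have := ih _ h.2 (by simp [hx, hp])
      rw [← this, List.filter_filter]
      congr 2
      funext y
      cases hy : p y <;> simp [hp, hy]
    · have := ih _ h.1 (by simp [hx, hp])
      rw [← this, List.filter_filter]
      congr 2
      funext y
      cases hy : p y <;> simp [hp, hy]

def e8ps : List (List ℤ → Bool) :=
  [fun l => match l with
    | [_, _, _, _, _, _, _, a7] => a7 % 2 == 0
    | _ => false,
   fun l => match l with
    | [_, _, _, _, _, _, a6, a7] => (a6 - a7) % 4 == 0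
    | _ => false,
   fun l => match l with
    | [_, _, _, _, _, a5, _, a7] => (a5 - a7) % 4 == 0
    | _ => false,
   fun l => match l with
    | [_, _, _, _, a4, _, _, a7] => (a4 - a7) % 4 == 0
    | _ => false,
   fun l => match l with
    | [_, _, _, a3, _, _, _, a7] => (a3 - a7) % 4 == 0
    | _ => false,
   fun l => match l with
    | [_, _, a2, _, _, _, _, a7] => (a2 - a7) % 4 == 0
    | _ => false,
   fun l => match l with
    | [_, a1, _, _, _, _, _, a7] => (a1 - a7) % 4 == 0
    | _ => false,
   fun l => match l with
    | [a0, a1, a2, a3, a4, a5, a6, a7] => (a0 + a1 + a2 + a3 + a4 + a5 + a6 - 7 * a7) % 8 == 0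
    | _ => false]

theorem e8ps_iff' (c d : Fin 8 → ℤ) :
    (e8ps.all fun p => p (e8toL c) == p (e8toL d)) = true ↔ e8par c = e8par d := by
  rw [e8par_eq, Fin.forall_fin_succ, Fin.forall_fin_succ, Fin.forall_fin_succ,
    Fin.forall_fin_succ, Fin.forall_fin_succ, Fin.forall_fin_succ, Fin.forall_fin_succ,
    Fin.forall_fin_succ]
  have hb : ∀ a b x y : ℤ, ((a % x == 0) = (b % y == 0)) ↔ (a % x = 0 ↔ b % y = 0) := by
    intro a b x y
    rw [Bool.eq_iff_iff, beq_iff_eq, beq_iff_eq]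
  simp only [e8ps, e8toL, List.all_cons, List.all_nil, Bool.and_eq_true, beq_iff_eq, hb]
  simp only [IsEmpty.forall_iff, and_true]
  change _ ↔ c 0 % 2 = d 0 % 2 ∧ c 1 % 2 = d 1 % 2 ∧ c 2 % 2 = d 2 % 2 ∧ c 3 % 2 = d 3 % 2 ∧
    c 4 % 2 = d 4 % 2 ∧ c 5 % 2 = d 5 % 2 ∧ c 6 % 2 = d 6 % 2 ∧ c 7 % 2 = d 7 % 2
  constructor
  · rintro ⟨h7, h6, h5, h4, h3, h2, h1, h0⟩
    have e7 : c 7 % 2 = d 7 % 2 := by clear h6 h5 h4 h3 h2 h1 h0; omega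
    have e6 : c 6 % 2 = d 6 % 2 := by clear h7 h5 h4 h3 h2 h1 h0; omega
    have e5 : c 5 % 2 = d 5 % 2 := by clear h7 h6 h4 h3 h2 h1 h0; omega
    have e4 : c 4 % 2 = d 4 % 2 := by clear h7 h6 h5 h3 h2 h1 h0; omega
    have e3 : c 3 % 2 = d 3 % 2 := by clear h7 h6 h5 h4 h2 h1 h0; omega
    have e2 : c 2 % 2 = d 2 % 2 := by clear h7 h6 h5 h4 h3 h1 h0; omega
    have e1 : c 1 % 2 = d 1 % 2 := by clear h7 h6 h5 h4 h3 h2 h0; omega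
    have e0 : c 0 % 2 = d 0 % 2 := by clear h7 h6 h5 h4 h3 h2 h1; omega
    exact ⟨e0, e1, e2, e3, e4, e5, e6, e7⟩
  · rintro ⟨h0, h1, h2, h3, h4, h5, h6, h7⟩
    refine ⟨?_, ?_, ?_, ?_, ?_, ?_, ?_, ?_⟩ <;> omega

theorem e8ps_iff {m : ℕ} {l l' : List ℤ} (hl : l ∈ e8L m) (hl' : l' ∈ e8L m) :
    (e8ps.all fun p => p l == p l') = true ↔ e8par (e8toC l) = e8par (e8toC l') := by
  rw [← e8ps_iff', e8toL_toC hl, e8toL_toC hl']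

theorem e8_len2 : (e8L 2).length = 240 := by decide +kernel
theorem e8_len4 : (e8L 4).length = 2160 := by decide +kernel
theorem e8_split2 : e8split 2 e8ps (e8L 2) = true := by decide +kernel
theorem e8_split4 : e8split 16 e8ps (e8L 4) = true := by decide +kernel

theorem e8_main (m : ℕ) (hm : m ≤ 4) (k : ℕ) (hs : e8split k e8ps (e8L m) = true) :
    (∀ x, x ∈ E8Set → ip x x = m →
      Set.ncard {y | y ∈ E8Set ∧ ip y y = m ∧ y ∈ cosetOf x} = k) ∧
    Set.ncard {S : Set (Fin 8 → ℚ) | ∃ x, x ∈ E8Set ∧ ip x x = m ∧ S = cosetOf x} * k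
      = (e8L m).length := by
  classical
  have inj : ∀ l ∈ e8L m, ∀ l' ∈ e8L m, e8E (e8toC l) = e8E (e8toC l') → l = l' := by
    intro l hl l' hl' h
    have := congrArg e8toL (e8E_inj h)
    rwa [e8toL_toC hl, e8toL_toC hl'] at this
  have fib : ∀ l ∈ e8L m,
      ((e8L m).toFinset.filter fun l' => e8par (e8toC l) = e8par (e8toC l')).card = k := by
    intro l hl
    rw [← e8split_spec k e8ps _ hs l hl, ← List.toFinset_card_of_nodup ((e8L_nodup m).filter _)]
    refine congrArg Finset.card (Finset.ext fun l' => ?_)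
    rw [Finset.mem_filter, List.mem_toFinset, List.mem_toFinset, List.mem_filter]
    exact and_congr_right fun hl' => (e8ps_iff hl hl').symm
  have ipL : ∀ l ∈ e8L m, ip (e8E (e8toC l)) (e8E (e8toC l)) = m := by
    intro l hl
    rw [e8_ip_iff m hm, e8toL_toC hl]
    exact hl
  constructor
  · intro x hx hxm
    obtain ⟨c, rfl⟩ := e8E_surj hx
    have hc := (e8_ip_iff m hm c).1 hxm
    rw [← fib _ hc, e8toC_toL, ← Set.ncard_coe_finset]
    have : {y | y ∈ E8Set ∧ ip y y = m ∧ y ∈ cosetOf (e8E c)} =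
        (fun l => e8E (e8toC l)) ''
          (((e8L m).toFinset.filter fun l' => e8par c = e8par (e8toC l') : Finset _) :
            Set (List ℤ)) := by
      ext y
      simp only [Set.mem_ofPred_eq, Set.mem_image, Finset.mem_coe, Finset.mem_filter,
        List.mem_toFinset]
      constructor
      · rintro ⟨h1, h2, h3⟩
        obtain ⟨d, rfl⟩ := e8E_surj h1
        refine ⟨e8toL d, ⟨(e8_ip_iff m hm d).1 h2, ?_⟩, by rw [e8toC_toL]⟩
        rw [e8toC_toL]
        exact (e8_mem_coset _ _).1 h3
      · rintro ⟨l, ⟨h1, h2⟩, rfl⟩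
        exact ⟨e8E_mem _, ipL l h1, (e8_mem_coset _ _).2 h2⟩
    rw [this]
    refine Set.ncard_image_of_injOn ?_
    intro l hl l' hl' h
    rw [Finset.mem_coe, Finset.mem_filter, List.mem_toFinset] at hl hl'
    exact inj l hl.1 l' hl'.1 h
  · have himg : {S : Set (Fin 8 → ℚ) | ∃ x, x ∈ E8Set ∧ ip x x = m ∧ S = cosetOf x} =
        (((e8L m).toFinset.image fun l => cosetOf (e8E (e8toC l)) : Finset _) :
          Set (Set (Fin 8 → ℚ))) := by
      ext S
      simp only [Set.mem_ofPred_eq, Finset.mem_coe, Finset.mem_image, List.mem_toFinset]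
      constructor
      · rintro ⟨x, h1, h2, rfl⟩
        obtain ⟨d, rfl⟩ := e8E_surj h1
        exact ⟨e8toL d, (e8_ip_iff m hm d).1 h2, by rw [e8toC_toL]⟩
      · rintro ⟨l, h1, rfl⟩
        exact ⟨_, e8E_mem _, ipL l h1, rfl⟩
    rw [himg, Set.ncard_coe_finset, ← List.toFinset_card_of_nodup (e8L_nodup m),
      Finset.card_eq_sum_card_image (fun l => cosetOf (e8E (e8toC l))) (e8L m).toFinset]
    rw [Finset.sum_const_nat (m := k)]
    intro S hS
    rw [Finset.mem_image] at hS
    obtain ⟨l, hl, rfl⟩ := hS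
    rw [← fib l (by simpa using hl)]
    refine congrArg Finset.card (Finset.ext fun l' => ?_)
    simp only [Finset.mem_filter, e8_coset_eq, eq_comm]

theorem e8_256 : Set.ncard {S : Set (Fin 8 → ℚ) | ∃ x ∈ E8Set, S = cosetOf x} = 256 := by
  have hpar : ∀ b : Fin 8 → Bool, e8par (fun i => if b i then 1 else 0) = b := by
    intro b
    funext i
    cases h : b i <;> simp [e8par, h]
  have : {S : Set (Fin 8 → ℚ) | ∃ x ∈ E8Set, S = cosetOf x} =
      (fun b : Fin 8 → Bool => cosetOf (e8E fun i => if b i then 1 else 0)) '' Set.univ := by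
    ext S
    simp only [Set.mem_ofPred_eq, Set.mem_image, Set.mem_univ, true_and]
    constructor
    · rintro ⟨x, hx, rfl⟩
      obtain ⟨c, rfl⟩ := e8E_surj hx
      exact ⟨e8par c, (e8_coset_eq _ _).2 (hpar _)⟩
    · rintro ⟨b, rfl⟩
      exact ⟨_, e8E_mem _, rfl⟩
  rw [this, Set.ncard_image_of_injective, Set.ncard_univ, Nat.card_eq_fintype_card]
  · simp
  · intro b b' h
    have := (e8_coset_eq _ _).1 h
    rwa [hpar, hpar] at this

/-- In `E8/2E8` (of order 256) there is 1 class represented by 0, 120 classes represented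
by roots — each containing exactly the pair `{α, -α}` of roots — and 135 classes
represented by norm-4 vectors, each containing exactly 16 norm-4 vectors. -/
theorem E8_mod_2E8_classes :
    Set.ncard {S : Set (Fin 8 → ℚ) | ∃ x ∈ E8Set, S = cosetOf x} = 256 ∧
    Set.ncard {S : Set (Fin 8 → ℚ) | S = cosetOf 0} = 1 ∧
    Set.ncard {S : Set (Fin 8 → ℚ) |
      ∃ α, α ∈ E8Set ∧ ip α α = 2 ∧ S = cosetOf α} = 120 ∧
    (∀ α, α ∈ E8Set → ip α α = 2 →
      {β | β ∈ E8Set ∧ ip β β = 2 ∧ β ∈ cosetOf α} = {α, -α}) ∧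
    Set.ncard {S : Set (Fin 8 → ℚ) |
      ∃ x, x ∈ E8Set ∧ ip x x = 4 ∧ S = cosetOf x} = 135 ∧
    (∀ x, x ∈ E8Set → ip x x = 4 →
      Set.ncard {y | y ∈ E8Set ∧ ip y y = 4 ∧ y ∈ cosetOf x} = 16) := by
  obtain ⟨h2a, h2b⟩ := e8_main 2 (by norm_num) 2 e8_split2
  obtain ⟨h4a, h4b⟩ := e8_main 4 (by norm_num) 16 e8_split4
  rw [e8_len2] at h2b
  rw [e8_len4] at h4b
  norm_num only [Nat.cast_ofNat] at h2a h2b h4a h4b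
  refine ⟨e8_256, by simp, by omega, ?_, by omega, h4a⟩
  intro α hα hn
  have hc := h2a α hα hn
  symm
  have hz : α ≠ -α := by
    intro h
    have h0 : α = 0 := by
      funext i
      have := congrFun h i
      simp at this ⊢
      linarith
    simp [h0, ip] at hn
  refine Set.eq_of_subset_of_ncard_le ?_ (by rw [hc, Set.ncard_pair hz])
    (Set.finite_of_ncard_ne_zero (by rw [hc]; norm_num))
  obtain ⟨c, rfl⟩ := e8E_surj hα
  have hneg : -e8E c = e8E (-c) := by
    funext i
    fin_cases i <;> simp [e8E] <;> ring
  rintro β (rfl | rfl)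
  · exact ⟨hα, hn, (e8_mem_coset _ _).2 rfl⟩
  · refine ⟨hneg ▸ e8E_mem _, by simpa [ip] using hn, ?_⟩
    rw [hneg, e8_mem_coset, e8par_eq]
    intro i
    simp
end
end

section
/- The number of subcodes of the Reed-Muller code RM(2,4) that are copies of the [8,4,4] Hamming code H8 (i.e., 4-dimensional doubly even subcodes supported on 8 coordinates whose restriction to their support is equivalent to H8) is exactly 30; moreover the support of every such subcode is a weight-8 codeword of RM(1,4). -/
open scoped Classical

noncomputable section

/-- The [8,4,4] Hamming code `H8`. -/
def H8 : Submodule (ZMod 2) (Fin 8 → ZMod 2) :=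
  Submodule.span (ZMod 2)
    {![1,1,1,1,1,1,1,1], ![1,1,1,1,0,0,0,0], ![1,1,0,0,1,1,0,0], ![1,0,1,0,1,0,1,0]}

/-- The `j`-th binary digit of the index `i`, viewed as a point of `𝔽₂⁴`. -/
def bit (i : Fin 16) (j : Fin 4) : ZMod 2 :=
  ((i.val / 2 ^ j.val) % 2 : ℕ)

/-- The Reed–Muller code `RM(r,4)` of length 16. -/
def RM (r : ℕ) : Submodule (ZMod 2) (Fin 16 → ZMod 2) :=
  Submodule.span (ZMod 2)
    {v | ∃ S : Finset (Fin 4), S.card ≤ r ∧ v = fun i => ∏ j ∈ S, bit i j}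

/-- Extension of a length-8 vector to length `m` along an injection of coordinates. -/
def extVec {m : ℕ} (s : Fin 8 → Fin m) (x : Fin 8 → ZMod 2) : Fin m → ZMod 2 :=
  fun j => ∑ i, if s i = j then x i else 0

/-- The copy of `H8` supported on the image of an injection `s` of coordinates. -/
def extCode {m : ℕ} (s : Fin 8 → Fin m) : Set (Fin m → ZMod 2) :=
  extVec s '' (H8 : Set (Fin 8 → ZMod 2))

def aff (a : Fin 4 → ZMod 2) (i : Fin 16) : ZMod 2 :=
  a 0 * bit i 0 + a 1 * bit i 1 + a 2 * bit i 2 + a 3 * bit i 3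

lemma bit_inj : ∀ i i' : Fin 16, (∀ j, bit i j = bit i' j) → i = i' := by decide

lemma zcases (x : ZMod 2) : x = 0 ∨ x = 1 := by revert x; decide

lemma ne_add : ∀ y c : ZMod 2, y ≠ c → 1 + c + y = 0 := by decide

lemma RM2_par (v : Fin 16 → ZMod 2) (hv : v ∈ RM 2) :
    (∑ i, v i = 0) ∧ ∀ j, ∑ i, v i * bit i j = 0 := by
  unfold RM at hv
  induction hv using Submodule.span_induction with
  | mem x hx =>
    obtain ⟨S, hS, rfl⟩ := hx
    revert S
    decide +kernel
  | zero => simp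
  | add x y _ _ hx hy =>
    refine ⟨?_, fun j => ?_⟩
    · simp [Finset.sum_add_distrib, hx.1, hy.1]
    · simp [add_mul, Finset.sum_add_distrib, hx.2 j, hy.2 j]
  | smul c x _ hx =>
    refine ⟨?_, fun j => ?_⟩
    · simp [← Finset.mul_sum, hx.1]
    · simp [mul_assoc, ← Finset.mul_sum, hx.2 j]

lemma sum_ext (s : Fin 8 → Fin 16) (x : Fin 8 → ZMod 2) (f : Fin 16 → ZMod 2) :
    ∑ i, extVec s x i * f i = ∑ k, x k * f (s k) := by
  simp only [extVec, Finset.sum_mul]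
  rw [Finset.sum_comm]
  simp [ite_mul]

lemma ext_at (s : Fin 8 → Fin 16) (hs : Function.Injective s) (x : Fin 8 → ZMod 2) (k : Fin 8) :
    extVec s x (s k) = x k := by
  simp [extVec, hs.eq_iff]

lemma ext_off (s : Fin 8 → Fin 16) (x : Fin 8 → ZMod 2) (j : Fin 16) (h : j ∉ Set.range s) :
    extVec s x j = 0 := by
  unfold extVec
  apply Finset.sum_eq_zero
  intro i _
  rw [if_neg]
  rintro rfl
  exact h ⟨i, rfl⟩

lemma H8_of_checks (x : Fin 8 → ZMod 2) (h0 : ∑ k, x k = 0)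
    (hA : x 1 + x 3 + x 5 + x 7 = 0) (hB : x 2 + x 3 + x 6 + x 7 = 0)
    (hC : x 4 + x 5 + x 6 + x 7 = 0) : x ∈ H8 := by
  have key : x = x 7 • ![1,1,1,1,1,1,1,1] + (x 7 + x 3) • ![1,1,1,1,0,0,0,0]
      + (x 7 + x 5) • ![1,1,0,0,1,1,0,0] + (x 7 + x 6) • ![1,0,1,0,1,0,1,0] := by
    simp only [Fin.sum_univ_eight] at h0
    ext k
    fin_cases k <;> simp <;> grind
  rw [key]
  unfold H8
  refine Submodule.add_mem _ (Submodule.add_mem _ (Submodule.add_mem _ ?_ ?_) ?_) ?_ <;>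
    exact Submodule.smul_mem _ _ (Submodule.subset_span (by simp))

/-- The point relations forced by the inclusion. -/
lemma rel (s : Fin 8 → Fin 16) (h : extCode s ⊆ (RM 2 : Set (Fin 16 → ZMod 2))) (j : Fin 4) :
    bit (s 3) j = bit (s 0) j + bit (s 1) j + bit (s 2) j ∧
    bit (s 5) j = bit (s 0) j + bit (s 1) j + bit (s 4) j ∧
    bit (s 6) j = bit (s 0) j + bit (s 2) j + bit (s 4) j ∧
    bit (s 7) j = bit (s 1) j + bit (s 2) j + bit (s 4) j := by
  have g : ∀ x ∈ H8, ∑ k, x k * bit (s k) j = 0 := fun x hx => by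
    rw [← sum_ext s x (fun i => bit i j)]
    exact (RM2_par _ (h ⟨x, hx, rfl⟩)).2 j
  have g1 := g ![1,1,1,1,1,1,1,1] (Submodule.subset_span (by simp))
  have g2 := g ![1,1,1,1,0,0,0,0] (Submodule.subset_span (by simp))
  have g3 := g ![1,1,0,0,1,1,0,0] (Submodule.subset_span (by simp))
  have g4 := g ![1,0,1,0,1,0,1,0] (Submodule.subset_span (by simp))
  simp [Fin.sum_univ_eight] at g1 g2 g3 g4
  grind

lemma card_hyp : ∀ a : Fin 4 → ZMod 2, a ≠ 0 → ∀ c, 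
    (Finset.univ.filter (fun i => aff a i = c)).card = 8 := by
  decide +kernel

lemma range_eq (s : Fin 8 → Fin 16) (hs : Function.Injective s) (a : Fin 4 → ZMod 2) (ha : a ≠ 0)
    (c : ZMod 2) (h : ∀ k, aff a (s k) = c) : ∀ i, i ∈ Set.range s ↔ aff a i = c := by
  have : Finset.univ.image s = Finset.univ.filter (fun i => aff a i = c) := by
    apply Finset.eq_of_subset_of_card_le
    · intro i hi
      obtain ⟨k, _, rfl⟩ := Finset.mem_image.1 hi
      simp [h]
    · rw [card_hyp a ha c, Finset.card_image_of_injective _ hs]; simp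
  intro i
  have h2 := Finset.ext_iff.1 this i
  simpa using h2

lemma exists_hyp (s : Fin 8 → Fin 16) (h : extCode s ⊆ (RM 2 : Set (Fin 16 → ZMod 2))) :
    ∃ a : Fin 4 → ZMod 2, a ≠ 0 ∧ ∀ k, aff a (s k) = aff a (s 0) := by
  let M : Matrix (Fin 3) (Fin 4) (ZMod 2) := fun r j => bit (s 0) j + bit (s (![1,2,4] r)) j
  have hk : LinearMap.ker M.mulVecLin ≠ ⊥ := LinearMap.ker_ne_bot_of_finrank_lt (by simp)
  obtain ⟨a, ha, ha0⟩ := Submodule.exists_mem_ne_zero_of_ne_bot hk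
  refine ⟨a, ha0, ?_⟩
  rw [LinearMap.mem_ker, Matrix.mulVecLin_apply] at ha
  have e0 : ∑ j, (bit (s 0) j + bit (s 1) j) * a j = 0 := congrFun ha 0
  have e1 : ∑ j, (bit (s 0) j + bit (s 2) j) * a j = 0 := congrFun ha 1
  have e2 : ∑ j, (bit (s 0) j + bit (s 4) j) * a j = 0 := congrFun ha 2
  simp only [Fin.sum_univ_four] at e0 e1 e2
  have r0 := rel s h 0
  have r1 := rel s h 1
  have r2 := rel s h 2
  have r3 := rel s h 3
  have t : (2 : ZMod 2) = 0 := by decide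
  have f1 : aff a (s 1) = aff a (s 0) := by unfold aff; linear_combination e0 - t * (a 0 * bit (s 0) 0 + a 1 * bit (s 0) 1 + a 2 * bit (s 0) 2 + a 3 * bit (s 0) 3)
  have f2 : aff a (s 2) = aff a (s 0) := by unfold aff; linear_combination e1 - t * (a 0 * bit (s 0) 0 + a 1 * bit (s 0) 1 + a 2 * bit (s 0) 2 + a 3 * bit (s 0) 3)
  have f4 : aff a (s 4) = aff a (s 0) := by unfold aff; linear_combination e2 - t * (a 0 * bit (s 0) 0 + a 1 * bit (s 0) 1 + a 2 * bit (s 0) 2 + a 3 * bit (s 0) 3)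
  have f3 : aff a (s 3) = aff a (s 0) + aff a (s 1) + aff a (s 2) := by
    unfold aff; rw [r0.1, r1.1, r2.1, r3.1]; ring
  have f5 : aff a (s 5) = aff a (s 0) + aff a (s 1) + aff a (s 4) := by
    unfold aff; rw [r0.2.1, r1.2.1, r2.2.1, r3.2.1]; ring
  have f6 : aff a (s 6) = aff a (s 0) + aff a (s 2) + aff a (s 4) := by
    unfold aff; rw [r0.2.2.1, r1.2.2.1, r2.2.2.1, r3.2.2.1]; ring
  have f7 : aff a (s 7) = aff a (s 1) + aff a (s 2) + aff a (s 4) := by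
    unfold aff; rw [r0.2.2.2, r1.2.2.2, r2.2.2.2, r3.2.2.2]; ring
  rw [f1, f2] at f3
  rw [f1, f4] at f5
  rw [f2, f4] at f6
  rw [f1, f2, f4] at f7
  intro k
  clear t; fin_cases k <;> simp <;> grind

def Dcode (p : (Fin 4 → ZMod 2) × ZMod 2) : Set (Fin 16 → ZMod 2) :=
  {v | v ∈ RM 2 ∧ ∀ i, aff p.1 i ≠ p.2 → v i = 0}

lemma code_eq (s : Fin 8 → Fin 16) (hs : Function.Injective s)
    (h : extCode s ⊆ (RM 2 : Set (Fin 16 → ZMod 2))) (a : Fin 4 → ZMod 2)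
    (c : ZMod 2) (hr : ∀ i, i ∈ Set.range s ↔ aff a i = c) : extCode s = Dcode (a, c) := by
  ext v
  constructor
  · intro hv
    refine ⟨h hv, fun i hi => ?_⟩
    obtain ⟨x, _, rfl⟩ := hv
    exact ext_off s x i (fun h' => hi ((hr i).1 h'))
  · rintro ⟨hv, h0⟩
    have hvx : v = extVec s (fun k => v (s k)) := by
      ext i
      by_cases hi : i ∈ Set.range s
      · obtain ⟨k, rfl⟩ := hi
        rw [ext_at s hs]
      · rw [ext_off s _ i hi]
        exact h0 i (fun h' => hi ((hr i).2 h'))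
    generalize (fun k => v (s k)) = x at hvx
    subst hvx
    refine ⟨x, ?_, rfl⟩
    obtain ⟨p0, p1⟩ := RM2_par _ hv
    have q0 : ∑ k, x k = 0 := by
      have := sum_ext s x (fun _ => 1)
      simp only [mul_one] at this
      rw [← this, p0]
    have q1 : ∀ j, (x 1 + x 3 + x 5 + x 7) * (bit (s 0) j + bit (s 1) j)
        + (x 2 + x 3 + x 6 + x 7) * (bit (s 0) j + bit (s 2) j)
        + (x 4 + x 5 + x 6 + x 7) * (bit (s 0) j + bit (s 4) j) = 0 := by
      intro j
      have e := p1 j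
      rw [sum_ext s x (fun i => bit i j)] at e
      have q0' := q0
      obtain ⟨r3, r5, r6, r7⟩ := rel s h j
      simp only [Fin.sum_univ_eight, r3, r5, r6, r7] at e q0'
      have t : (2 : ZMod 2) = 0 := by decide
      linear_combination e - bit (s 0) j * q0' + t * bit (s 0) j *
        (x 1 + x 2 + x 4 + x 3 + x 5 + x 6 + 2 * x 7)
    have no : ∀ k, k ≠ 0 → ¬ ∀ j, bit (s k) j = bit (s 0) j := fun k hk hj =>
      hk (hs (bit_inj _ _ hj))
    have R := rel s h
    have key : (x 1 + x 3 + x 5 + x 7) = 0 ∧ (x 2 + x 3 + x 6 + x 7) = 0 ∧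
        (x 4 + x 5 + x 6 + x 7) = 0 := by
      generalize (x 1 + x 3 + x 5 + x 7) = A at *
      generalize (x 2 + x 3 + x 6 + x 7) = B at *
      generalize (x 4 + x 5 + x 6 + x 7) = C at *
      rcases zcases A with rfl | rfl <;> rcases zcases B with rfl | rfl <;>
        rcases zcases C with rfl | rfl
      · simp
      · exact (no 4 (by decide) fun j => by have := q1 j; have := R j; grind).elim
      · exact (no 2 (by decide) fun j => by have := q1 j; have := R j; grind).elim
      · exact (no 6 (by decide) fun j => by have := q1 j; have := R j; grind).elim
      · exact (no 1 (by decide) fun j => by have := q1 j; have := R j; grind).elim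
      · exact (no 5 (by decide) fun j => by have := q1 j; have := R j; grind).elim
      · exact (no 3 (by decide) fun j => by have := q1 j; have := R j; grind).elim
      · exact (no 7 (by decide) fun j => by have := q1 j; have := R j; grind).elim
    exact H8_of_checks x q0 key.1 key.2.1 key.2.2

lemma mono_mem (r : ℕ) (S : Finset (Fin 4)) (h : S.card ≤ r) :
    (fun i => ∏ j ∈ S, bit i j) ∈ RM r := Submodule.subset_span ⟨S, h, rfl⟩

lemma one_mem (r : ℕ) : (fun _ => 1 : Fin 16 → ZMod 2) ∈ RM r := by
  simpa using mono_mem r ∅ (by simp)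

lemma bit_mem (r : ℕ) (hr : 1 ≤ r) (j : Fin 4) : (fun i => bit i j) ∈ RM r := by
  simpa using mono_mem r {j} (by simpa using hr)

lemma bit2_mem (j k : Fin 4) : (fun i => bit i j * bit i k) ∈ RM 2 := by
  by_cases h : j = k
  · subst h
    have : (fun i => bit i j * bit i j) = fun i => bit i j := by
      ext i
      rcases zcases (bit i j) with h | h <;> rw [h] <;> rfl
    rw [this]
    exact bit_mem 2 (by norm_num) j
  · have := mono_mem 2 {j, k} (by rw [Finset.card_pair h])
    simpa [Finset.prod_pair h] using this

lemma hyp_mem (r : ℕ) (hr : 1 ≤ r) (a : Fin 4 → ZMod 2) (c : ZMod 2) :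
    (fun i => 1 + c + aff a i) ∈ RM r := by
  have e : (fun i => 1 + c + aff a i) = (1 + c) • (fun _ => 1 : Fin 16 → ZMod 2)
    + a 0 • (fun i => bit i 0) + a 1 • (fun i => bit i 1) + a 2 • (fun i => bit i 2)
    + a 3 • (fun i => bit i 3) := by
    ext i; simp [aff]; ring
  rw [e]
  refine Submodule.add_mem _ (Submodule.add_mem _ (Submodule.add_mem _ (Submodule.add_mem _ ?_ ?_) ?_) ?_) ?_ <;>
    apply Submodule.smul_mem
  · exact one_mem r
  all_goals exact bit_mem r hr _

lemma hyp2_mem (a : Fin 4 → ZMod 2) (c : ZMod 2) (k : Fin 4) :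
    (fun i => (1 + c + aff a i) * (1 + bit i k)) ∈ RM 2 := by
  have e : (fun i => (1 + c + aff a i) * (1 + bit i k)) = (fun i => 1 + c + aff a i)
    + ((1 + c) • (fun i => bit i k)
    + a 0 • (fun i => bit i 0 * bit i k) + a 1 • (fun i => bit i 1 * bit i k)
    + a 2 • (fun i => bit i 2 * bit i k) + a 3 • (fun i => bit i 3 * bit i k)) := by
    ext i; simp [aff]; ring
  rw [e]
  refine Submodule.add_mem _ (hyp_mem 2 (by norm_num) a c) ?_
  refine Submodule.add_mem _ (Submodule.add_mem _ (Submodule.add_mem _ (Submodule.add_mem _ ?_ ?_) ?_) ?_) ?_ <;>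
    apply Submodule.smul_mem
  · exact bit_mem 2 (by norm_num) k
  all_goals exact bit2_mem _ _

def piv (a : Fin 4 → ZMod 2) : Fin 4 :=
  if a 0 = 1 then 0 else if a 1 = 1 then 1 else if a 2 = 1 then 2 else 3

/-- the parametrisation of the hyperplane with equation `a · x = c` -/
def par (a : Fin 4 → ZMod 2) (c : ZMod 2) (k : Fin 8) : Fin 16 :=
  let p := piv a
  let y : Fin 4 → ZMod 2 := fun j =>
    if j = p.succAbove 0 then ((k.val / 4 : ℕ) : ZMod 2)
    else if j = p.succAbove 1 then ((k.val / 2 : ℕ) : ZMod 2)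
    else if j = p.succAbove 2 then ((k.val : ℕ) : ZMod 2) else 0
  let z := c + (a 0 * y 0 + a 1 * y 1 + a 2 * y 2 + a 3 * y 3)
  let w : Fin 4 → ZMod 2 := fun j => if j = p then z else y j
  Fin.ofNat 16 ((w 0).val + 2 * (w 1).val + 4 * (w 2).val + 8 * (w 3).val)

lemma par_spec : ∀ a : Fin 4 → ZMod 2, a ≠ 0 → ∀ c,
    (∀ k, aff a (par a c k) = c) ∧ (∀ k l, par a c k = par a c l → k = l) ∧
    (∀ k, (1 + bit (par a c k) ((piv a).succAbove 0) = (![1,1,1,1,0,0,0,0] : Fin 8 → ZMod 2) k) ∧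
     (1 + bit (par a c k) ((piv a).succAbove 1) = (![1,1,0,0,1,1,0,0] : Fin 8 → ZMod 2) k) ∧
     (1 + bit (par a c k) ((piv a).succAbove 2) = (![1,0,1,0,1,0,1,0] : Fin 8 → ZMod 2) k)) := by
  decide +kernel

lemma ext_prod (s : Fin 8 → Fin 16) (hs : Function.Injective s) (a : Fin 4 → ZMod 2) (c : ZMod 2)
    (hr : ∀ i, i ∈ Set.range s ↔ aff a i = c) (x : Fin 8 → ZMod 2) (f : Fin 16 → ZMod 2)
    (hf : ∀ k, f (s k) = x k) : extVec s x = fun i => (1 + c + aff a i) * f i := by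
  have t : (2 : ZMod 2) = 0 := by decide
  ext i
  by_cases hi : i ∈ Set.range s
  · have h1 := (hr i).1 hi
    obtain ⟨k, rfl⟩ := hi
    rw [ext_at s hs, hf, h1]
    linear_combination - c * x k * t
  · rw [ext_off s x i hi]
    have h1 : aff a i ≠ c := fun h => hi ((hr i).2 h)
    have : 1 + c + aff a i = 0 := by
      exact ne_add _ _ h1
    rw [this, zero_mul]

def extL (s : Fin 8 → Fin 16) : (Fin 8 → ZMod 2) →ₗ[ZMod 2] (Fin 16 → ZMod 2) where
  toFun := extVec s
  map_add' x y := by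
    ext j
    simp only [extVec, Pi.add_apply, ← Finset.sum_add_distrib]
    exact Finset.sum_congr rfl fun i _ => by split_ifs <;> simp
  map_smul' c x := by
    ext j
    simp only [extVec, Pi.smul_apply, smul_eq_mul, Finset.mul_sum, RingHom.id_apply]
    exact Finset.sum_congr rfl fun i _ => by split_ifs <;> simp

lemma back (a : Fin 4 → ZMod 2) (ha : a ≠ 0) (c : ZMod 2) :
    ∃ s : Fin 8 → Fin 16, Function.Injective s ∧ Dcode (a, c) = extCode s ∧
      Dcode (a, c) ⊆ (RM 2 : Set (Fin 16 → ZMod 2)) := by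
  obtain ⟨h1, h2, h3⟩ := par_spec a ha c
  have hs : Function.Injective (par a c) := fun k l => h2 k l
  have hr := range_eq _ hs a ha c h1
  have hsub : extCode (par a c) ⊆ (RM 2 : Set (Fin 16 → ZMod 2)) := by
    have : H8 ≤ (RM 2).comap (extL (par a c)) := by
      unfold H8
      rw [Submodule.span_le]
      intro x hx
      change extVec (par a c) x ∈ RM 2
      simp only [Set.mem_insert_iff, Set.mem_singleton_iff] at hx
      rcases hx with rfl | rfl | rfl | rfl
      · rw [ext_prod _ hs a c hr _ (fun _ => 1) (by decide)]
        simpa using hyp_mem 2 (by norm_num) a c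
      · rw [ext_prod _ hs a c hr _ (fun i => 1 + bit i ((piv a).succAbove 0)) (fun k => (h3 k).1)]
        exact hyp2_mem a c _
      · rw [ext_prod _ hs a c hr _ (fun i => 1 + bit i ((piv a).succAbove 1)) (fun k => (h3 k).2.1)]
        exact hyp2_mem a c _
      · rw [ext_prod _ hs a c hr _ (fun i => 1 + bit i ((piv a).succAbove 2)) (fun k => (h3 k).2.2)]
        exact hyp2_mem a c _
    rintro _ ⟨x, hx, rfl⟩
    exact this hx
  exact ⟨par a c, hs, (code_eq _ hs hsub a c hr).symm, fun v hv => hv.1⟩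

lemma supp (s : Fin 8 → Fin 16) (hs : Function.Injective s) (j : Fin 16) :
    (∃ x ∈ extCode s, x j ≠ 0) ↔ j ∈ Set.range s := by
  constructor
  · rintro ⟨_, ⟨x, _, rfl⟩, h⟩
    by_contra h'
    exact h (ext_off s x j h')
  · rintro ⟨k, rfl⟩
    refine ⟨_, ⟨![1,1,1,1,1,1,1,1], Submodule.subset_span (by simp), rfl⟩, ?_⟩
    rw [ext_at s hs]
    revert k; decide

lemma aff_inj : ∀ a : Fin 4 → ZMod 2, a ≠ 0 → ∀ c, ∀ a' : Fin 4 → ZMod 2, a' ≠ 0 → ∀ c',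
    (∀ i, aff a i = c ↔ aff a' i = c') → a = a' ∧ c = c' := by
  decide +kernel

lemma supp_D (a : Fin 4 → ZMod 2) (ha : a ≠ 0) (c : ZMod 2) (i : Fin 16) :
    (∃ x ∈ Dcode (a, c), x i ≠ 0) ↔ aff a i = c := by
  constructor
  · rintro ⟨x, hx, h⟩
    by_contra h'
    exact h (hx.2 i h')
  · intro h
    obtain ⟨s, hs, h1, h2⟩ := back a ha c
    refine ⟨fun i => 1 + c + aff a i, ⟨hyp_mem 2 (by norm_num) a c, fun i hi => ?_⟩, ?_⟩
    · exact ne_add _ _ hi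
    · simp only [h]; clear h h1 h2; revert c; decide

/-- There are exactly 30 copies of the Hamming code `H8` inside `RM(2,4)`, and the
support of each such copy is a weight-8 codeword of `RM(1,4)`. -/
theorem count_H8_in_RM24 :
    Set.ncard {D : Set (Fin 16 → ZMod 2) |
      ∃ s : Fin 8 → Fin 16, Function.Injective s ∧ D = extCode s ∧
        D ⊆ (RM 2 : Set (Fin 16 → ZMod 2))} = 30 ∧
    (∀ (s : Fin 8 → Fin 16), Function.Injective s →
      extCode s ⊆ (RM 2 : Set (Fin 16 → ZMod 2)) →
      (fun j : Fin 16 => if ∃ x ∈ extCode s, x j ≠ 0 then (1 : ZMod 2) else 0) ∈ RM 1 ∧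
      Set.ncard {j : Fin 16 | ∃ x ∈ extCode s, x j ≠ 0} = 8) := by
  constructor
  · have e : {D : Set (Fin 16 → ZMod 2) |
      ∃ s : Fin 8 → Fin 16, Function.Injective s ∧ D = extCode s ∧
        D ⊆ (RM 2 : Set (Fin 16 → ZMod 2))} =
        Dcode '' ((Finset.univ.filter (fun p : (Fin 4 → ZMod 2) × ZMod 2 => p.1 ≠ 0) :
          Finset ((Fin 4 → ZMod 2) × ZMod 2)) : Set ((Fin 4 → ZMod 2) × ZMod 2)) := by
      ext D
      constructor
      · rintro ⟨s, hs, rfl, h⟩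
        obtain ⟨a, ha, hk⟩ := exists_hyp s h
        exact ⟨(a, aff a (s 0)), by simpa using ha,
          (code_eq s hs h a _ (range_eq s hs a ha _ hk)).symm⟩
      · rintro ⟨⟨a, c⟩, ha, rfl⟩
        exact back a (by simpa using ha) c
    rw [e, Set.InjOn.ncard_image, Set.ncard_coe_finset]
    · have hc : ∀ (inst : DecidablePred fun p : (Fin 4 → ZMod 2) × ZMod 2 => p.1 ≠ 0),
          (@Finset.filter _ (fun p : (Fin 4 → ZMod 2) × ZMod 2 => p.1 ≠ 0) inst
            Finset.univ).card = 30 := by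
        intro inst
        have : (@Finset.filter _ (fun p : (Fin 4 → ZMod 2) × ZMod 2 => p.1 ≠ 0) 
          (fun p => instDecidableNot) Finset.univ).card = 30 := by decide +kernel
        convert this
      exact hc _
    · rintro ⟨a, c⟩ ha ⟨a', c'⟩ ha' h
      have ha : a ≠ 0 := by simpa using ha
      have ha' : a' ≠ 0 := by simpa using ha'
      obtain ⟨h1, h2⟩ := aff_inj a ha c a' ha' c' (fun i => by
        rw [← supp_D a ha c, ← supp_D a' ha' c', h])
      rw [h1, h2]
  · intro s hs h
    obtain ⟨a, ha, hk⟩ := exists_hyp s h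
    have hr := range_eq s hs a ha _ hk
    constructor
    · convert hyp_mem 1 le_rfl a (aff a (s 0)) using 1
      ext j
      simp only [supp s hs, hr]
      generalize aff a (s 0) = c
      generalize aff a j = y
      by_cases hy : y = c
      · subst hy; simp; revert y; decide
      · rw [if_neg hy]; revert y c; decide
    · simp only [supp s hs]
      change Set.ncard (Set.range s) = 8
      rw [← Set.image_univ, Set.ncard_image_of_injective _ hs]
      simp
end
end
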